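/- arXiv:1508.04127 — 4 statements merged into one kernel-verified Lean document; each statement's English description precedes it below -/
import Mathlib

section
/- Let A^{(1)}, …, A^{(M)} be measurable subsets of 𝒳 with joint operating point u given by u_i = ∫_{∩_{m=1}^M (A^{(m)})^{i_m}} p(x) dx for i ∈ {0,1}^M, and for y ∈ 𝒴^M set η(y) = Σ_{i∈{0,1}^M} u_i q_i(y), with Bayes posterior p_y(x) = p(x) · q_{i(x)}(y)/η(y) when η(y) > 0, where i(x) ∈ {0,1}^M is determined by i(x)_m = 1 iff x ∈ A^{(m)} (and p_y = p when η(y) = 0). Then H(p) − Σ_{y∈𝒴^M} η(y) H(p_y) = φ(u). (Proposition 4 of the paper.) -/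
open MeasureTheory Finset Real

/-- Shannon entropy of a function on a finite set (convention `0 * log 0 = 0`
is automatic since `Real.log 0 = 0`). -/
noncomputable def shannonEntropy {S : Type*} [Fintype S] (f : S → ℝ) : ℝ :=
  -∑ s, f s * Real.log (f s)

/-- `f` is a probability mass function on the finite set `S`. -/
def IsPmf {S : Type*} [Fintype S] (f : S → ℝ) : Prop :=
  (∀ s, 0 ≤ f s) ∧ ∑ s, f s = 1

/-- `φ(u) = 𝓗(Σ_i u_i q_i) − Σ_i u_i 𝓗(q_i)`. -/
noncomputable def phiGen {I Y : Type*} [Fintype I] [Fintype Y]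
    (q : I → Y → ℝ) (u : I → ℝ) : ℝ :=
  shannonEntropy (fun y => ∑ i, u i * q i y) - ∑ i, u i * shannonEntropy (q i)

/-- Differential entropy of a density `p` on the region `X`. -/
noncomputable def diffEntropy {α : Type*} [MeasureSpace α] (X : Set α) (p : α → ℝ) : ℝ :=
  -∫ x in X, p x * Real.log (p x)

/-- The joint (product-channel) pmf on `𝒴^M`:
`q_i(y) = Π_m f^{(m)}_{i_m}(y^{(m)})`, where `i ∈ {0,1}^M` is encoded as
`Fin M → Bool`. -/
noncomputable def qJoint {M : ℕ} {Y : Type*} (f : Fin M → Bool → Y → ℝ)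
    (i : Fin M → Bool) (y : Fin M → Y) : ℝ :=
  ∏ m, f m (i m) (y m)

/-- The cell `∩_m (A^{(m)})^{i_m}` of the partition of `X` generated by the
sets `A^{(m)}` (here `B^1 = B` and `B^0 = X \ B`). -/
def cellM {α : Type*} {M : ℕ} (X : Set α) (A : Fin M → Set α)
    (i : Fin M → Bool) : Set α :=
  ⋂ m, (if i m then A m else X \ A m)

open scoped Classical in
/-- Bayes posterior density for joint sensing: after observing
`y = (y^{(1)},…,y^{(M)})` with subsets `A^{(1)},…,A^{(M)}`,
`p_y(x) = p(x) q_{i(x)}(y)/η(y)` where `i(x)_m = 1` iff `x ∈ A^{(m)}` and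
`η(y) = Σ_i u_i q_i(y)`; `p_y = p` when `η(y) = 0`. -/
noncomputable def bayesPostM {α : Type*} [MeasureSpace α] {M : ℕ} {Y : Type*} [Fintype Y]
    (X : Set α) (p : α → ℝ) (A : Fin M → Set α)
    (f : Fin M → Bool → Y → ℝ) (y : Fin M → Y) : α → ℝ :=
  if (∑ i : Fin M → Bool, (∫ x in cellM X A i, p x) * qJoint f i y) = 0 then p
  else fun x =>
    p x * qJoint f (fun m => decide (x ∈ A m)) y /
      (∑ i : Fin M → Bool, (∫ x in cellM X A i, p x) * qJoint f i y)

open scoped Classical in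
theorem cellM_mem_iff_aux {α : Type*} {M : ℕ} (hM : 2 ≤ M) (X : Set α) (A : Fin M → Set α)
    (hAX : ∀ m, A m ⊆ X) (i : Fin M → Bool) (x : α) :
    x ∈ cellM X A i ↔ (x ∈ X ∧ (fun m => decide (x ∈ A m)) = i) := by
  unfold cellM
  rw [Set.mem_iInter]
  constructor
  · intro h
    refine ⟨?_, ?_⟩
    · have h0 := h ⟨0, by omega⟩
      split_ifs at h0 with hc
      · exact hAX _ h0
      · exact h0.1
    · funext m
      have h0 := h m
      split_ifs at h0 with hc
      · simp [hc, h0]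
      · simp only [Bool.not_eq_true] at hc
        simp [hc, h0.2]
  · rintro ⟨hx, rfl⟩ m
    by_cases hm : x ∈ A m <;> simp [hm, hx]

open scoped Classical in
theorem int_cell_aux {α : Type*} [MeasureSpace α] {M : ℕ} (hM : 2 ≤ M) (X : Set α)
    (hX : MeasurableSet X) (A : Fin M → Set α) (hAm : ∀ m, MeasurableSet (A m))
    (hAX : ∀ m, A m ⊆ X) (w : α → ℝ) (hw : Integrable w (volume.restrict X))
    (g : (Fin M → Bool) → ℝ) :
    Integrable (fun x => w x * g (fun m => decide (x ∈ A m))) (volume.restrict X) ∧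
    ∫ x in X, w x * g (fun m => decide (x ∈ A m)) = ∑ i, (∫ x in cellM X A i, w x) * g i := by
  have hc : ∀ i, MeasurableSet (cellM X A i) := by
    intro i
    refine MeasurableSet.iInter fun m => ?_
    split_ifs
    · exact hAm m
    · exact hX.diff (hAm m)
  have hsub : ∀ i, cellM X A i ⊆ X := fun i x hx =>
    ((cellM_mem_iff_aux hM X A hAX i x).1 hx).1
  have hint : ∀ i, Integrable (fun x => (cellM X A i).indicator w x * g i)
      (volume.restrict X) := fun i => (hw.indicator (hc i)).mul_const _
  have heq : ∀ x ∈ X, ∑ i, (cellM X A i).indicator w x * g i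
      = w x * g (fun m => decide (x ∈ A m)) := by
    intro x hx
    rw [Finset.sum_eq_single (fun m => decide (x ∈ A m))]
    · rw [Set.indicator_of_mem ((cellM_mem_iff_aux hM X A hAX _ x).2 ⟨hx, rfl⟩)]
    · intro i _ hi
      rw [Set.indicator_of_notMem, zero_mul]
      intro h
      exact hi ((cellM_mem_iff_aux hM X A hAX _ x).1 h).2.symm
    · simp
  constructor
  · refine (integrable_finsetSum Finset.univ fun i _ => hint i).congr ?_
    filter_upwards [ae_restrict_mem hX] with x hx using heq x hx
  · rw [← setIntegral_congr_fun hX heq, integral_finsetSum _ fun i _ => hint i]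
    refine Finset.sum_congr rfl fun i _ => ?_
    rw [integral_mul_const, setIntegral_indicator (hc i),
      Set.inter_eq_self_of_subset_right (hsub i)]

theorem qJoint_sum_aux {M : ℕ} {Y : Type*} [Fintype Y] (f : Fin M → Bool → Y → ℝ)
    (hf : ∀ m b, IsPmf (f m b)) (i : Fin M → Bool) : ∑ y, qJoint f i y = 1 := by
  unfold qJoint
  rw [← Fintype.prod_sum (fun m y => f m (i m) y)]
  exact Finset.prod_eq_one fun m _ => (hf m (i m)).2

/-- **Proposition 4.** For joint sensing with subsets `A^{(1)},…,A^{(M)}` with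
joint operating point `u_i = ∫_{∩_m (A^{(m)})^{i_m}} p`, the expected reduction
in differential entropy equals `φ(u)`. -/
theorem expected_entropy_reduction_eq_phi_multisensor
    {d M : ℕ} (hM : 2 ≤ M) {Y : Type*} [Fintype Y] [Nonempty Y]
    (X : Set (Fin d → ℝ)) (hX : IsCompact X)
    (f : Fin M → Bool → Y → ℝ) (hf : ∀ m b, IsPmf (f m b))
    (p : (Fin d → ℝ) → ℝ)
    (hp0 : ∀ x, 0 ≤ p x)
    (hpsupp : ∀ x ∉ X, p x = 0)
    (hp1 : ∫ x in X, p x = 1)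
    (hpEnt : Integrable (fun x => p x * Real.log (p x)) (volume.restrict X))
    (A : Fin M → Set (Fin d → ℝ))
    (hAm : ∀ m, MeasurableSet (A m))
    (hAX : ∀ m, A m ⊆ X)
    (hPostEnt : ∀ y : Fin M → Y,
      Integrable
        (fun x => bayesPostM X p A f y x * Real.log (bayesPostM X p A f y x))
        (volume.restrict X)) :
    diffEntropy X p -
        ∑ y : Fin M → Y,
          (∑ i : Fin M → Bool, (∫ x in cellM X A i, p x) * qJoint f i y) *
            diffEntropy X (bayesPostM X p A f y)
      = phiGen (qJoint f) (fun i => ∫ x in cellM X A i, p x) := by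
  classical
  have hXm := hX.measurableSet
  have hpi : Integrable p (volume.restrict X) := by
    by_contra h
    rw [integral_undef h] at hp1
    exact zero_ne_one hp1
  have hq0 : ∀ i y, 0 ≤ qJoint f i y := fun i y =>
    Finset.prod_nonneg fun m _ => (hf m (i m)).1 _
  set u : (Fin M → Bool) → ℝ := fun i => ∫ x in cellM X A i, p x with hu
  set v : (Fin M → Bool) → ℝ := fun i => ∫ x in cellM X A i, p x * Real.log (p x) with hv
  have key : ∀ y : Fin M → Y, (∑ i, u i * qJoint f i y) * diffEntropy X (bayesPostM X p A f y)
      = -(∑ i, v i * qJoint f i y) - ∑ i, u i * (qJoint f i y * Real.log (qJoint f i y))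
        + (∑ i, u i * qJoint f i y) * Real.log (∑ i, u i * qJoint f i y) := by
    intro y
    obtain ⟨i1, e1⟩ := int_cell_aux hM X hXm A hAm hAX p hpi (fun i => qJoint f i y)
    obtain ⟨i2, e2⟩ := int_cell_aux hM X hXm A hAm hAX _ hpEnt (fun i => qJoint f i y)
    obtain ⟨i3, e3⟩ := int_cell_aux hM X hXm A hAm hAX p hpi
      (fun i => qJoint f i y * Real.log (qJoint f i y))
    change _ = ∑ i, u i * _ at e1
    change _ = ∑ i, v i * _ at e2
    change _ = ∑ i, u i * _ at e3
    by_cases hη : (∑ i, u i * qJoint f i y) = 0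
    · have hz := (integral_eq_zero_iff_of_nonneg
        (fun x => mul_nonneg (hp0 x) (hq0 _ y)) i1).1 (e1.trans hη)
      rw [hη, ← e2, ← e3]
      rw [integral_eq_zero_of_ae, integral_eq_zero_of_ae]
      · simp
      · filter_upwards [hz] with x hx
        simp only [Pi.zero_apply] at hx ⊢
        rw [← mul_assoc, hx, zero_mul]
      · filter_upwards [hz] with x hx
        simp only [Pi.zero_apply] at hx ⊢
        rw [mul_right_comm, hx, zero_mul]
    · have hb : bayesPostM X p A f y = fun x =>
          p x * qJoint f (fun m => decide (x ∈ A m)) y / (∑ i, u i * qJoint f i y) := by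
        unfold bayesPostM
        rw [if_neg hη]
      rw [hb, diffEntropy, mul_neg, ← integral_const_mul, ← e2, ← e3]
      generalize (∑ i, u i * qJoint f i y) = η at *

      have : ∀ x, η * (p x * qJoint f (fun m => decide (x ∈ A m)) y / η *
          Real.log (p x * qJoint f (fun m => decide (x ∈ A m)) y / η)) =
          p x * Real.log (p x) * qJoint f (fun m => decide (x ∈ A m)) y +
          p x * (qJoint f (fun m => decide (x ∈ A m)) y *
            Real.log (qJoint f (fun m => decide (x ∈ A m)) y)) -
          p x * qJoint f (fun m => decide (x ∈ A m)) y * Real.log η := by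
        intro x
        generalize qJoint f (fun m => decide (x ∈ A m)) y = q
        by_cases h1 : p x = 0
        · simp [h1]
        by_cases h2 : q = 0
        · simp [h2]
        rw [Real.log_div (mul_ne_zero h1 h2) hη, Real.log_mul h1 h2]
        field_simp
      rw [integral_congr_ae (ae_of_all _ this), integral_sub (by exact i2.add i3) (by exact i1.mul_const _),
        integral_add i2 i3, integral_mul_const, e1]
      ring
  have hv1 : ∑ i, v i = ∫ x in X, p x * Real.log (p x) := by
    have := (int_cell_aux hM X hXm A hAm hAX _ hpEnt (fun _ => 1)).2
    simp only [mul_one] at this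
    exact this.symm
  have hs : ∑ y : Fin M → Y, ∑ i, v i * qJoint f i y = ∑ i, v i := by
    rw [Finset.sum_comm]
    refine Finset.sum_congr rfl fun i _ => ?_
    rw [← Finset.mul_sum, qJoint_sum_aux f hf, mul_one]
  change diffEntropy X p - ∑ y : Fin M → Y,
    (∑ i, u i * qJoint f i y) * diffEntropy X (bayesPostM X p A f y) = _
  rw [Finset.sum_congr rfl fun y _ => key y]
  rw [Finset.sum_add_distrib, Finset.sum_sub_distrib, Finset.sum_neg_distrib, hs, hv1,
    Finset.sum_comm (f := fun y i => u i * (qJoint f i y * Real.log (qJoint f i y)))]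
  simp only [phiGen, shannonEntropy, diffEntropy, mul_neg, Finset.sum_neg_distrib,
    Finset.mul_sum]
  ring
end

section
/- For each sensor m let u^{(m)*} ∈ [0,1] be a maximizer of φ^{(m)} over [0,1]. Then the product pmf u* on {0,1}^M defined by u*_i = Π_{m=1}^M (u^{(m)*})^{i_m} (1 − u^{(m)*})^{1−i_m} maximizes φ over all pmfs on {0,1}^M, and max_u φ(u) = Σ_{m=1}^M max_{v∈[0,1]} φ^{(m)}(v). (Proposition 7 of the paper: the joint optimal operating point decouples into single-sensor problems.) -/
open Finset Real

/-- Single-sensor expected entropy reduction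
`φ^{(m)}(v) = 𝓗(v f_1 + (1−v) f_0) − v 𝓗(f_1) − (1−v) 𝓗(f_0)`. -/
noncomputable def phiSingle {Y : Type*} [Fintype Y] (f0 f1 : Y → ℝ) (v : ℝ) : ℝ :=
  shannonEntropy (fun y => v * f1 y + (1 - v) * f0 y)
    - v * shannonEntropy f1 - (1 - v) * shannonEntropy f0


lemma sum_prod_one {M : ℕ} {T : Type*} [Fintype T] (r : Fin M → T → ℝ) :
    ∑ y : Fin M → T, ∏ k, r k (y k) = ∏ k, ∑ s, r k s := by
  classical
  rw [Finset.prod_univ_sum, Fintype.piFinset_univ]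

lemma sum_prod_mul {M : ℕ} {T : Type*} [Fintype T] (r : Fin M → T → ℝ)
    (hr : ∀ m, ∑ s, r m s = 1) (m : Fin M) (g : T → ℝ) :
    ∑ y : Fin M → T, (∏ k, r k (y k)) * g (y m) = ∑ s, r m s * g s := by
  classical
  have h1 : ∀ y : Fin M → T, (∏ k, r k (y k)) * g (y m)
      = ∏ k, (fun k s => r k s * (if k = m then g s else 1)) k (y k) := by
    intro y
    simp only [Finset.prod_mul_distrib]
    simp
  rw [Finset.sum_congr rfl (fun y _ => h1 y),
    sum_prod_one (fun k s => r k s * (if k = m then g s else 1))]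
  rw [Finset.prod_eq_single m]
  · simp
  · intro k _ hk
    simp [hk, hr]
  · simp

lemma entropy_prod {M : ℕ} {T : Type*} [Fintype T] (r : Fin M → T → ℝ)
    (hr : ∀ m, ∑ s, r m s = 1) :
    shannonEntropy (fun y : Fin M → T => ∏ k, r k (y k)) = ∑ m, shannonEntropy (r m) := by
  have h1 : ∀ y : Fin M → T, (∏ k, r k (y k)) * Real.log (∏ k, r k (y k))
      = ∑ m, (∏ k, r k (y k)) * Real.log (r m (y m)) := by
    intro y
    rw [← Finset.mul_sum]
    by_cases h : ∏ k, r k (y k) = 0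
    · simp [h]
    · rw [Real.log_prod]
      intro k hk
      exact (Finset.prod_ne_zero_iff.mp h) k hk
  unfold shannonEntropy
  rw [Finset.sum_congr rfl (fun y _ => h1 y), Finset.sum_comm, Finset.sum_neg_distrib]
  congr 1
  refine Finset.sum_congr rfl fun m _ => ?_
  exact sum_prod_mul r hr m (fun s => Real.log (r m s))

lemma gibbs_term {p r : ℝ} (hp : 0 ≤ p) (hr : 0 ≤ r) (h : r = 0 → p = 0) :
    p - r ≤ p * Real.log p - p * Real.log r := by
  rcases hp.eq_or_lt with h0 | h0
  · rw [← h0]; simpa using hr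
  · have hr' : 0 < r := lt_of_le_of_ne hr (fun e => h0.ne' (h e.symm))
    have := Real.log_le_sub_one_of_pos (div_pos hr' h0)
    rw [Real.log_div hr'.ne' h0.ne'] at this
    have h2 := mul_le_mul_of_nonneg_left this h0.le
    have h3 : p * (r / p - 1) = r - p := by field_simp
    rw [h3] at h2
    linarith

/-- Subadditivity of entropy for a mixture of product pmfs. -/
lemma entropy_mix_le {M : ℕ} {Y : Type*} [Fintype Y]
    (f : Fin M → Bool → Y → ℝ) (hf : ∀ m b, IsPmf (f m b))
    (u : (Fin M → Bool) → ℝ) (hu : ∀ i, 0 ≤ u i) (hu1 : ∑ i, u i = 1) :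
    shannonEntropy (fun y => ∑ i, u i * qJoint f i y) ≤
      ∑ m, shannonEntropy (fun s => ∑ i, u i * f m (i m) s) := by
  set p : (Fin M → Y) → ℝ := fun y => ∑ i, u i * qJoint f i y with hp
  set w : Fin M → Y → ℝ := fun m s => ∑ i, u i * f m (i m) s with hw
  have hw0 : ∀ m s, 0 ≤ w m s := fun m s =>
    Finset.sum_nonneg fun i _ => mul_nonneg (hu i) ((hf m (i m)).1 s)
  have hp0 : ∀ y, 0 ≤ p y := fun y =>
    Finset.sum_nonneg fun i _ => mul_nonneg (hu i)
      (Finset.prod_nonneg fun m _ => (hf m (i m)).1 _)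
  have hw1 : ∀ m, ∑ s, w m s = 1 := by
    intro m
    simp only [hw]
    rw [Finset.sum_comm]
    simp only [← Finset.mul_sum, (hf _ _).2, mul_one, hu1]
  have hmarg : ∀ m (g : Y → ℝ), ∑ y, p y * g (y m) = ∑ s, w m s * g s := by
    intro m g
    simp only [hp, hw, Finset.sum_mul]
    rw [Finset.sum_comm, Finset.sum_comm (s := (Finset.univ : Finset Y))]
    refine Finset.sum_congr rfl fun i _ => ?_
    simp only [mul_assoc, ← Finset.mul_sum]
    congr 1
    exact sum_prod_mul (fun k => f k (i k)) (fun k => (hf k (i k)).2) m g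
  have hp1 : ∑ y, p y = 1 := by
    simp only [hp]
    rw [Finset.sum_comm]
    simp only [← Finset.mul_sum, qJoint]
    rw [← hu1]
    refine Finset.sum_congr rfl fun i _ => ?_
    rw [sum_prod_one (fun k => f k (i k))]
    simp [(hf _ _).2]
  have hr1 : ∑ y : Fin M → Y, ∏ m, w m (y m) = 1 := by
    rw [sum_prod_one]; simp [hw1]
  have hac : ∀ y : Fin M → Y, ∀ m, w m (y m) = 0 → p y = 0 := by
    intro y m h
    have h' := (Finset.sum_eq_zero_iff_of_nonneg (fun i _ =>
      mul_nonneg (hu i) ((hf m (i m)).1 (y m)))).mp h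
    refine Finset.sum_eq_zero fun i hi => ?_
    rcases mul_eq_zero.mp (h' i hi) with h0 | h0
    · simp [h0]
    · have : qJoint f i y = 0 := Finset.prod_eq_zero (Finset.mem_univ m) h0
      simp [this]
  have hlog : ∀ y : Fin M → Y, p y * Real.log (∏ m, w m (y m))
      = ∑ m, p y * Real.log (w m (y m)) := by
    intro y
    rw [← Finset.mul_sum]
    by_cases h : p y = 0
    · simp [h]
    · rw [Real.log_prod]
      exact fun k _ hk => h (hac y k hk)
  have hg : ∑ y, (p y - ∏ m, w m (y m)) ≤
      ∑ y, (p y * Real.log (p y) - p y * Real.log (∏ m, w m (y m))) := by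
    refine Finset.sum_le_sum fun y _ => gibbs_term (hp0 y)
      (Finset.prod_nonneg fun m _ => hw0 m _) fun h => ?_
    obtain ⟨m, _, hm⟩ := Finset.prod_eq_zero_iff.mp h
    exact hac y m hm
  rw [Finset.sum_sub_distrib, Finset.sum_sub_distrib, hp1, hr1,
    Finset.sum_congr rfl (fun y _ => hlog y), Finset.sum_comm,
    Finset.sum_congr rfl (fun m _ => hmarg m (fun s => Real.log (w m s)))] at hg
  unfold shannonEntropy
  rw [Finset.sum_neg_distrib]
  linarith

lemma cond_entropy_eq {M : ℕ} {Y : Type*} [Fintype Y]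
    (f : Fin M → Bool → Y → ℝ) (hf : ∀ m b, IsPmf (f m b))
    (u : (Fin M → Bool) → ℝ) :
    ∑ i, u i * shannonEntropy (qJoint f i)
      = ∑ m, ∑ i, u i * shannonEntropy (f m (i m)) := by
  rw [Finset.sum_comm]
  refine Finset.sum_congr rfl fun i _ => ?_
  rw [← Finset.mul_sum]
  congr 1
  exact entropy_prod (fun k => f k (i k)) (fun k => (hf k (i k)).2)

lemma single_eq {M : ℕ} {Y : Type*} [Fintype Y]
    (f : Fin M → Bool → Y → ℝ) (u : (Fin M → Bool) → ℝ) (m : Fin M) (v : ℝ)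
    (hv : ∀ h : Bool → ℝ, ∑ i, u i * h (i m) = v * h true + (1 - v) * h false) :
    shannonEntropy (fun s => ∑ i, u i * f m (i m) s)
      - ∑ i, u i * shannonEntropy (f m (i m)) = phiSingle (f m false) (f m true) v := by
  unfold phiSingle
  rw [hv (fun b => shannonEntropy (f m b))]
  have : (fun s => ∑ i, u i * f m (i m) s)
      = fun s => v * f m true s + (1 - v) * f m false s := by
    funext s
    exact hv (fun b => f m b s)
  rw [this]
  ring

/-- **Proposition 7.** If `u^{(m)*}` maximizes `φ^{(m)}` over `[0,1]` for each
sensor `m`, then the product pmf `u*_i = Π_m (u^{(m)*})^{i_m}(1−u^{(m)*})^{1−i_m}`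
maximizes `φ` over all pmfs on `{0,1}^M`, and
`max φ = Σ_m max φ^{(m)}`. -/
theorem joint_operating_point_decouples
    {M : ℕ} (hM : 2 ≤ M) {Y : Type*} [Fintype Y] [Nonempty Y]
    (f : Fin M → Bool → Y → ℝ) (hf : ∀ m b, IsPmf (f m b))
    (us : Fin M → ℝ)
    (husmem : ∀ m, us m ∈ Set.Icc (0 : ℝ) 1)
    (husmax : ∀ m, ∀ v ∈ Set.Icc (0 : ℝ) 1,
      phiSingle (f m false) (f m true) v ≤ phiSingle (f m false) (f m true) (us m)) :
    (fun i : Fin M → Bool => ∏ m, if i m then us m else 1 - us m)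
        ∈ stdSimplex ℝ (Fin M → Bool) ∧
    (∀ u ∈ stdSimplex ℝ (Fin M → Bool),
      phiGen (qJoint f) u ≤
        phiGen (qJoint f) (fun i => ∏ m, if i m then us m else 1 - us m)) ∧
    phiGen (qJoint f) (fun i => ∏ m, if i m then us m else 1 - us m)
      = ∑ m, phiSingle (f m false) (f m true) (us m) := by
  have hr1 : ∀ m, ∑ b : Bool, (fun (m : Fin M) (b : Bool) => if b then us m else 1 - us m) m b
      = 1 := by
    intro m; simp
  have heq : phiGen (qJoint f) (fun i => ∏ m, if i m then us m else 1 - us m)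
      = ∑ m, phiSingle (f m false) (f m true) (us m) := by
    have hv : ∀ m (h : Bool → ℝ), ∑ i : Fin M → Bool,
        (∏ k, if i k then us k else 1 - us k) * h (i m)
          = us m * h true + (1 - us m) * h false := by
      intro m h
      have := sum_prod_mul (fun (m : Fin M) (b : Bool) => if b then us m else 1 - us m) hr1 m h
      simpa using this
    unfold phiGen
    rw [cond_entropy_eq f hf]
    have hw1 : ∀ m, ∑ s, (fun (m : Fin M) (s : Y) =>
        us m * f m true s + (1 - us m) * f m false s) m s = 1 := by
      intro m
      simp only [Finset.sum_add_distrib, ← Finset.mul_sum, (hf _ _).2]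
      ring
    have hp : (fun y : Fin M → Y => ∑ i : Fin M → Bool,
        (∏ m, if i m then us m else 1 - us m) * qJoint f i y)
        = fun y => ∏ m, (fun (m : Fin M) (s : Y) =>
          us m * f m true s + (1 - us m) * f m false s) m (y m) := by
      funext y
      unfold qJoint
      simp only [← Finset.prod_mul_distrib]
      rw [sum_prod_one (fun (m : Fin M) (b : Bool) =>
        (if b then us m else 1 - us m) * f m b (y m))]
      simp
    rw [hp, entropy_prod _ hw1, ← Finset.sum_sub_distrib]
    refine Finset.sum_congr rfl fun m _ => ?_
    rw [← single_eq f _ m (us m) (hv m)]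
    congr 2
    funext s
    exact (hv m (fun b => f m b s)).symm
  refine ⟨⟨?_, ?_⟩, ?_, heq⟩
  · intro i
    refine Finset.prod_nonneg fun m _ => ?_
    have := husmem m
    split_ifs
    · exact this.1
    · linarith [this.2]
  · rw [sum_prod_one (fun (m : Fin M) (b : Bool) => if b then us m else 1 - us m)]
    simp
  · intro u hu
    rw [heq]
    unfold phiGen
    rw [cond_entropy_eq f hf]
    have h1 := entropy_mix_le f hf u hu.1 hu.2
    have h2 : ∀ m, shannonEntropy (fun s => ∑ i, u i * f m (i m) s)
        - ∑ i, u i * shannonEntropy (f m (i m)) ≤ phiSingle (f m false) (f m true) (us m) := by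
      intro m
      have hc : ∑ i, u i * (if i m then (1 : ℝ) else 0)
          + ∑ i, u i * (if i m then (0 : ℝ) else 1) = 1 := by
        rw [← Finset.sum_add_distrib]
        refine Eq.trans ?_ hu.2
        refine Finset.sum_congr rfl fun i _ => ?_
        split_ifs <;> simp
      have hn1 : 0 ≤ ∑ i, u i * (if i m then (1 : ℝ) else 0) :=
        Finset.sum_nonneg fun i _ => mul_nonneg (hu.1 i) (by split_ifs <;> simp)
      have hn0 : 0 ≤ ∑ i, u i * (if i m then (0 : ℝ) else 1) :=
        Finset.sum_nonneg fun i _ => mul_nonneg (hu.1 i) (by split_ifs <;> simp)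
      rw [single_eq f u m (∑ i, u i * (if i m then (1 : ℝ) else 0))]
      · exact husmax m _ ⟨hn1, by linarith⟩
      · intro h
        rw [← eq_sub_iff_add_eq'.mpr hc, Finset.sum_mul, Finset.sum_mul,
          ← Finset.sum_add_distrib]
        refine Finset.sum_congr rfl fun i _ => ?_
        cases hi : i m <;> simp
    have h3 := Finset.sum_le_sum fun m (_ : m ∈ Finset.univ) => h2 m
    rw [Finset.sum_sub_distrib] at h3
    linarith
end

section
/- For every pmf u on {0,1}^M, one has φ(u) ≤ Σ_{m=1}^M φ^{(m)}(a^{(m)}), where a^{(m)} = Σ_{i ∈ {0,1}^M : i_m = 1} u_i is the m-th marginal of u. (The subadditivity step in the proof of Proposition 7, using subadditivity of Shannon entropy and additivity of entropy for the product channel pmfs q_i.) -/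
open Finset Real

lemma aux_marg {M : ℕ} {Y : Type*} [Fintype Y] (F : Fin M → Y → ℝ)
    (hF : ∀ m, ∑ z, F m z = 1) (g : Y → ℝ) (m0 : Fin M) :
    ∑ y : Fin M → Y, (∏ m, F m (y m)) * g (y m0) = ∑ z, F m0 z * g z := by
  classical
  have h1 : ∀ y : Fin M → Y, (∏ m, F m (y m)) * g (y m0)
      = ∏ m, (F m (y m) * if m = m0 then g (y m) else 1) := by
    intro y
    rw [Finset.prod_mul_distrib]
    congr 1
    rw [Finset.prod_ite_eq' Finset.univ m0 (fun m => g (y m))]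
    simp
  rw [Finset.sum_congr rfl (fun y _ => h1 y)]
  have h2 := Finset.prod_univ_sum (fun _ : Fin M => (Finset.univ : Finset Y))
    (fun m z => F m z * if m = m0 then g z else 1)
  rw [Fintype.piFinset_univ] at h2
  rw [← h2, Finset.prod_eq_single m0]
  · simp
  · intro b _ hb
    simp [hb, hF]
  · simp

lemma aux_sum_prod {M : ℕ} {Y : Type*} [Fintype Y] (F : Fin M → Y → ℝ)
    (hF : ∀ m, ∑ z, F m z = 1) :
    ∑ y : Fin M → Y, (∏ m, F m (y m)) = 1 := by
  classical
  have h2 := Finset.prod_univ_sum (fun _ : Fin M => (Finset.univ : Finset Y))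
    (fun m z => F m z)
  rw [Fintype.piFinset_univ] at h2
  rw [← h2]
  simp [hF]

lemma aux_mul_log_prod {M : ℕ} (p : ℝ) (a : Fin M → ℝ) (h : ∀ m, a m = 0 → p = 0) :
    p * Real.log (∏ m, a m) = ∑ m, p * Real.log (a m) := by
  by_cases hp : p = 0
  · simp [hp]
  · rw [Real.log_prod (fun m _ h0 => hp (h m h0)), Finset.mul_sum]

lemma aux_entropy_prod {M : ℕ} {Y : Type*} [Fintype Y] (F : Fin M → Y → ℝ)
    (hF : ∀ m, ∑ z, F m z = 1) :
    shannonEntropy (fun y : Fin M → Y => ∏ m, F m (y m)) = ∑ m, shannonEntropy (F m) := by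
  unfold shannonEntropy
  rw [Finset.sum_neg_distrib]
  congr 1
  rw [Finset.sum_congr rfl (fun y _ => aux_mul_log_prod (∏ m, F m (y m)) (fun m => F m (y m))
    (fun m hm => Finset.prod_eq_zero (Finset.mem_univ m) hm)), Finset.sum_comm]
  exact Finset.sum_congr rfl (fun m _ => aux_marg F hF (fun z => Real.log (F m z)) m)

lemma aux_gibbs_pt (p r : ℝ) (hp : 0 ≤ p) (hr : 0 ≤ r) (h : r = 0 → p = 0) :
    p * Real.log r - p * Real.log p ≤ r - p := by
  rcases hp.eq_or_lt with h0 | h0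
  · simp [← h0, hr]
  · have hr0 : r ≠ 0 := fun h1 => h0.ne' (h h1)
    have hrp : 0 < r / p := div_pos (lt_of_le_of_ne hr hr0.symm) h0
    have h1 := Real.log_le_sub_one_of_pos hrp
    rw [Real.log_div hr0 h0.ne'] at h1
    have h2 := mul_le_mul_of_nonneg_left h1 hp
    have h3 : p * (r / p - 1) = r - p := by field_simp
    linarith

lemma aux_bool {M : ℕ} (u : (Fin M → Bool) → ℝ) (hu : ∑ i, u i = 1) (m : Fin M)
    (c : Bool → ℝ) :
    ∑ i, u i * c (i m) = (∑ i : Fin M → Bool, if i m then u i else 0) * c true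
      + (1 - ∑ i : Fin M → Bool, if i m then u i else 0) * c false := by
  rw [← hu, ← Finset.sum_sub_distrib, Finset.sum_mul, Finset.sum_mul, ← Finset.sum_add_distrib]
  refine Finset.sum_congr rfl (fun i _ => ?_)
  cases i m <;> simp

lemma aux_subadd {M : ℕ} {Y : Type*} [Fintype Y]
    (f : Fin M → Bool → Y → ℝ) (hf : ∀ m b, IsPmf (f m b))
    (u : (Fin M → Bool) → ℝ) (hu : IsPmf u) :
    shannonEntropy (fun y => ∑ i, u i * qJoint f i y) ≤
      ∑ m, shannonEntropy (fun z => ∑ i, u i * f m (i m) z) := by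
  set P : Fin M → Y → ℝ := fun m z => ∑ i, u i * f m (i m) z with hP
  set p : (Fin M → Y) → ℝ := fun y => ∑ i, u i * qJoint f i y with hp
  have hP0 : ∀ m z, 0 ≤ P m z := fun m z =>
    Finset.sum_nonneg (fun i _ => mul_nonneg (hu.1 i) ((hf _ _).1 _))
  have hp0 : ∀ y, 0 ≤ p y := fun y =>
    Finset.sum_nonneg (fun i _ => mul_nonneg (hu.1 i)
      (Finset.prod_nonneg (fun m _ => (hf _ _).1 _)))
  have hP1 : ∀ m, ∑ z, P m z = 1 := by
    intro m
    simp only [hP]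
    rw [Finset.sum_comm]
    simp_rw [← Finset.mul_sum, (hf _ _).2, mul_one]
    exact hu.2
  have hp1 : ∑ y, p y = 1 := by
    simp only [hp, qJoint]
    rw [Finset.sum_comm]
    simp_rw [← Finset.mul_sum]
    rw [← hu.2]
    refine Finset.sum_congr rfl (fun i _ => ?_)
    rw [aux_sum_prod (fun m => f m (i m)) (fun m => (hf _ _).2), mul_one]
  have hz : ∀ y m, P m (y m) = 0 → p y = 0 := by
    intro y m h
    have h' := (Finset.sum_eq_zero_iff_of_nonneg
      (fun i _ => mul_nonneg (hu.1 i) ((hf m (i m)).1 (y m)))).1 h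
    refine Finset.sum_eq_zero (fun i hi => ?_)
    rcases mul_eq_zero.1 (h' i hi) with h1 | h1
    · simp [h1]
    · rw [qJoint, Finset.prod_eq_zero (Finset.mem_univ m) h1, mul_zero]
  have hG : ∑ y, (p y * Real.log (∏ m, P m (y m)) - p y * Real.log (p y))
      ≤ ∑ y, ((∏ m, P m (y m)) - p y) := by
    refine Finset.sum_le_sum (fun y _ => aux_gibbs_pt _ _ (hp0 y)
      (Finset.prod_nonneg (fun m _ => hP0 _ _)) (fun h => ?_))
    obtain ⟨m, _, hm⟩ := Finset.prod_eq_zero_iff.1 h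
    exact hz y m hm
  rw [Finset.sum_sub_distrib, Finset.sum_sub_distrib, hp1, aux_sum_prod P hP1] at hG
  have hE : ∑ y, p y * Real.log (∏ m, P m (y m)) = ∑ m, ∑ z, P m z * Real.log (P m z) := by
    rw [Finset.sum_congr rfl (fun y _ => aux_mul_log_prod (p y) (fun m => P m (y m)) (hz y)),
      Finset.sum_comm]
    refine Finset.sum_congr rfl (fun m _ => ?_)
    generalize hg : (fun z => Real.log (P m z)) = g
    have hg' : ∀ z, Real.log (P m z) = g z := fun z => congrFun hg z
    simp_rw [hg']
    simp only [hp, hP, Finset.sum_mul]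
    rw [Finset.sum_comm, Finset.sum_comm (s := (Finset.univ : Finset Y))]
    refine Finset.sum_congr rfl (fun i _ => ?_)
    simp_rw [mul_assoc, ← Finset.mul_sum]
    congr 1
    exact aux_marg (fun m => f m (i m)) (fun m => (hf _ _).2) g m
  unfold shannonEntropy
  rw [Finset.sum_neg_distrib]
  linarith


/-- **Subadditivity step of Proposition 7.** For every pmf `u` on `{0,1}^M`,
`φ(u) ≤ Σ_m φ^{(m)}(a^{(m)})`, where `a^{(m)} = Σ_{i : i_m = 1} u_i` is the
`m`-th marginal of `u`. -/
theorem phi_le_sum_phiSingle_marginals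
    {M : ℕ} (hM : 2 ≤ M) {Y : Type*} [Fintype Y] [Nonempty Y]
    (f : Fin M → Bool → Y → ℝ) (hf : ∀ m b, IsPmf (f m b))
    (u : (Fin M → Bool) → ℝ) (hu : IsPmf u) :
    phiGen (qJoint f) u ≤
      ∑ m, phiSingle (f m false) (f m true)
        (∑ i : Fin M → Bool, if i m then u i else 0) := by

  have h1 := aux_subadd f hf u hu
  have h2 : ∑ i, u i * shannonEntropy (qJoint f i)
      = ∑ m, ∑ i, u i * shannonEntropy (f m (i m)) := by
    rw [Finset.sum_comm]
    refine Finset.sum_congr rfl (fun i _ => ?_)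
    rw [← Finset.mul_sum]
    congr 1
    exact aux_entropy_prod (fun m => f m (i m)) (fun m => (hf _ _).2)
  unfold phiGen
  rw [h2]
  refine (sub_le_sub_right h1 _).trans (le_of_eq ?_)
  rw [← Finset.sum_sub_distrib]
  refine Finset.sum_congr rfl (fun m _ => ?_)
  unfold phiSingle
  rw [aux_bool u hu.2 m (fun b => shannonEntropy (f m b)), sub_sub]
  congr 2
  funext z
  exact aux_bool u hu.2 m (fun b => f m b z)
end

section
/- Suppose each sensor m has a quasi-symmetric error model, i.e. there exists a bijection χ_m : 𝒴 → 𝒴 such that f_1^{(m)}(y) = f_0^{(m)}(χ_m(y)) and f_0^{(m)}(y) = f_1^{(m)}(χ_m(y)) for all y ∈ 𝒴. Then the uniform pmf u* on {0,1}^M, given by u*_i = 2^{−M} for all i, maximizes φ over all pmfs on {0,1}^M. (Corollary 1 of the paper.) -/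
open Finset Real

theorem entropy_perm_aux {S : Type*} [Fintype S] (g : S → ℝ) (e : S ≃ S) :
    shannonEntropy (fun s => g (e s)) = shannonEntropy g := by
  unfold shannonEntropy
  rw [Equiv.sum_comp e (fun s => g s * Real.log (g s))]

theorem sum_xor_aux {M : ℕ} (g : (Fin M → Bool) → ℝ) (i : Fin M → Bool) :
    ∑ k : Fin M → Bool, g (fun m => xor (i m) (k m)) = ∑ k, g k := by
  have hinv : Function.Involutive (fun (k : Fin M → Bool) => fun m => xor (i m) (k m)) := by
    intro k
    funext m
    simp
  exact Equiv.sum_comp hinv.toPerm g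

/-- **Corollary 1.** If every sensor has a quasi-symmetric error model (there
is a bijection `χ_m : 𝒴 → 𝒴` swapping `f_1^{(m)}` and `f_0^{(m)}`), then the
uniform pmf `u*_i = 2^{−M}` maximizes `φ` over all pmfs on `{0,1}^M`. -/
theorem uniform_maximizes_phi_of_quasiSymmetric
    {M : ℕ} (hM : 2 ≤ M) {Y : Type*} [Fintype Y] [Nonempty Y]
    (f : Fin M → Bool → Y → ℝ) (hf : ∀ m b, IsPmf (f m b))
    (hsym : ∀ m, ∃ χ : Y ≃ Y,
      ∀ y, f m true y = f m false (χ y) ∧ f m false y = f m true (χ y)) :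
    ∀ u ∈ stdSimplex ℝ (Fin M → Bool),
      phiGen (qJoint f) u ≤
        phiGen (qJoint f) (fun _ : Fin M → Bool => ((1 : ℝ) / 2) ^ M) := by
  classical
  intro u hu
  obtain ⟨hu0, hu1⟩ := hu
  choose χ hχ using hsym
  let P : (Fin M → Bool) → ((Fin M → Y) ≃ (Fin M → Y)) := fun k =>
    Equiv.piCongrRight (fun m => if k m then χ m else Equiv.refl Y)
  have hP : ∀ k i y, qJoint f i (P k y) = qJoint f (fun m => xor (i m) (k m)) y := by
    intro k i y
    unfold qJoint
    refine Finset.prod_congr rfl fun m _ => ?_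
    have h1 := (hχ m (y m)).1
    have h2 := (hχ m (y m)).2
    simp only [P, Equiv.piCongrRight_apply, Pi.map_apply]
    cases hk : k m <;> cases hi : i m <;> simp [h1, h2]
  have hq0 : ∀ i y, 0 ≤ qJoint f i y := fun i y =>
    Finset.prod_nonneg fun m _ => (hf m (i m)).1 _
  have hent : ∀ i, shannonEntropy (qJoint f i) = shannonEntropy (qJoint f (fun _ => false)) := by
    intro i
    rw [← entropy_perm_aux (qJoint f (fun _ => false)) (P i)]
    congr 1
    funext y
    rw [hP]
    simp
  have hw1 : ∑ _k : Fin M → Bool, ((1 : ℝ) / 2) ^ M = 1 := by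
    simp
  have hw0 : (0 : ℝ) ≤ (1 / 2) ^ M := by positivity
  unfold phiGen
  simp only [hent, ← Finset.sum_mul, hu1, hw1]
  refine sub_le_sub_right ?_ _
  set mix : (Fin M → Y) → ℝ := fun y => ∑ i, u i * qJoint f i y with hmix
  have hmix0 : ∀ y, 0 ≤ mix y := fun y =>
    Finset.sum_nonneg fun i _ => mul_nonneg (hu0 i) (hq0 i y)
  have havg : ∀ y, ∑ k, ((1 : ℝ) / 2) ^ M * mix (P k y)
      = ∑ i, ((1 : ℝ) / 2) ^ M * qJoint f i y := by
    intro y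
    simp only [hmix, hP, ← Finset.mul_sum]
    rw [Finset.sum_comm]
    simp only [← Finset.mul_sum]
    simp only [fun i => sum_xor_aux (fun k => qJoint f k y) i]
    rw [← Finset.sum_mul, hu1, one_mul]
  have hJ : ∀ y, ∑ k, ((1 : ℝ) / 2) ^ M * Real.negMulLog (mix (P k y))
      ≤ Real.negMulLog (∑ i, ((1 : ℝ) / 2) ^ M * qJoint f i y) := by
    intro y
    rw [← havg y]
    have := Real.concaveOn_negMulLog.le_map_sum (t := Finset.univ)
      (w := fun _ : Fin M → Bool => ((1 : ℝ) / 2) ^ M) (p := fun k => mix (P k y))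
      (fun _ _ => hw0) hw1 (fun k _ => hmix0 _)
    simpa only [smul_eq_mul] using this
  have hH : ∀ g : (Fin M → Y) → ℝ, shannonEntropy g = ∑ y, Real.negMulLog (g y) := by
    intro g
    simp [shannonEntropy, Real.negMulLog]
  have hsum := Finset.sum_le_sum fun y (_ : y ∈ (Finset.univ : Finset (Fin M → Y))) => hJ y
  rw [Finset.sum_comm] at hsum
  simp only [← Finset.mul_sum _ _ (((1 : ℝ) / 2) ^ M)] at hsum
  have hre : ∀ k, ∑ y, Real.negMulLog (mix (P k y)) = shannonEntropy mix := by
    intro k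
    rw [hH]
    exact Equiv.sum_comp (P k) (fun y => Real.negMulLog (mix y))
  simp only [hre] at hsum
  rw [Finset.mul_sum, ← Finset.sum_mul, hw1, one_mul] at hsum
  rw [hH (fun y => ∑ i, ((1 : ℝ) / 2) ^ M * qJoint f i y)]
  simpa only [Finset.mul_sum, Finset.sum_mul] using hsum
end
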